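/- Suppose A ∈ GL_n(ℂ) with M_1(A) ∈ (1/2, 1) and let c ∈ (M_1(A), 1). Define A_1 = A and A_{m+1} = A_m ⊗ A_m. Then for all m ≥ 1, M_1(A_m) < f^{m-1}(c), where f(x) = x² + (1-x)². -/

import Mathlib

open Matrix Kronecker

/-- `M₁ A` : the algebraic multiplicity of the eigenvalue `1` of `A`, divided by the size. -/
noncomputable def M1 {m : Type*} [Fintype m] [DecidableEq m] (A : Matrix m m ℂ) : ℝ :=
  (A.charpoly.roots.count 1 : ℝ) / Fintype.card m


lemma aux_det {m : Type*} [Fintype m] [DecidableEq m] (A : Matrix m m ℂ) (v : m → ℂ)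
    (h : A.charpoly = ∏ i, (Polynomial.X - Polynomial.C (v i))) (x y : ℂ) :
    (x • (1 : Matrix m m ℂ) - y • A).det = ∏ i, (x - y * v i) := by
  by_cases hy : y = 0
  · subst hy
    simp
  · have h1 : x • (1 : Matrix m m ℂ) - y • A = y • (Matrix.scalar m (x / y) - A) := by
      rw [smul_sub]
      congr 1
      ext i j
      by_cases hij : i = j
      · subst hij; simp; field_simp
      · simp [hij]
    rw [h1, det_smul, ← eval_charpoly, h, Polynomial.eval_prod, ← Finset.card_univ,
      ← Finset.prod_const, ← Finset.prod_mul_distrib]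
    refine Finset.prod_congr rfl fun i _ => ?_
    simp
    field_simp

lemma aux_kron {m k : Type} [Fintype m] [DecidableEq m] [Fintype k] [DecidableEq k]
    (A : Matrix m m ℂ) (B : Matrix k k ℂ) (v : m → ℂ) (w : k → ℂ)
    (h : A.charpoly = ∏ i, (Polynomial.X - Polynomial.C (v i)))
    (h' : B.charpoly = ∏ i, (Polynomial.X - Polynomial.C (w i))) :
    (A ⊗ₖ B).charpoly = ∏ p : m × k, (Polynomial.X - Polynomial.C (v p.1 * w p.2)) := by
  apply Polynomial.funext
  intro x
  let M : Matrix m m (Polynomial ℂ) :=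
    (Polynomial.C x) • (1 : Matrix m m (Polynomial ℂ)) - (Polynomial.X : Polynomial ℂ) • A.map Polynomial.C
  have hM : M.det = ∏ i, (Polynomial.C x - Polynomial.X * Polynomial.C (v i)) := by
    apply Polynomial.funext
    intro y
    rw [Polynomial.eval_prod]
    have := aux_det A v h x y
    simp only [Polynomial.eval_sub, Polynomial.eval_mul, Polynomial.eval_C, Polynomial.eval_X]
    rw [← this, ← Polynomial.coe_evalRingHom, RingHom.map_det]
    congr 1
    ext i j
    by_cases hij : i = j
    · subst hij; simp [M]; try ring
    · simp [M, hij]; try ring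
  let f : Polynomial ℂ →+* Matrix k k ℂ := (Polynomial.aeval B : Polynomial ℂ →ₐ[ℂ] _).toRingHom
  have hdd := Matrix.det_det (M := M) f
  rw [hM] at hdd
  let φ : Polynomial ℂ →* ℂ := (Matrix.detMonoidHom).comp (f : Polynomial ℂ →* Matrix k k ℂ)
  have hL : (f (∏ i, (Polynomial.C x - Polynomial.X * Polynomial.C (v i)))).det
      = ∏ i, ∏ j, (x - v i * w j) := by
    change φ _ = _
    rw [map_prod]
    refine Finset.prod_congr rfl fun i _ => ?_
    rw [← aux_det B w h' x (v i)]
    change (f _).det = _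
    congr 1
    simp [f, Algebra.algebraMap_eq_smul_one]
  rw [hL] at hdd
  rw [Polynomial.eval_prod, Fintype.prod_prod_type, eval_charpoly]
  simp only [Polynomial.eval_sub, Polynomial.eval_C, Polynomial.eval_X]
  rw [hdd]
  congr 1
  ext ⟨i, a⟩ ⟨j, b⟩
  change _ = f (M i j) a b
  by_cases hij : i = j
  · subst hij
    by_cases hab : a = b
    · subst hab; simp [M, f, Algebra.algebraMap_eq_smul_one]; try ring
    · simp [M, f, Algebra.algebraMap_eq_smul_one, hab]; try ring
  · simp [M, f, Algebra.algebraMap_eq_smul_one, hij]; try ring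

lemma aux_exists {m : Type*} [Fintype m] [DecidableEq m] (A : Matrix m m ℂ) :
    ∃ v : m → ℂ, A.charpoly = ∏ i, (Polynomial.X - Polynomial.C (v i)) := by
  have hs : A.charpoly.Splits := IsAlgClosed.splits _
  have hc : A.charpoly.roots.toList.length = Fintype.card m := by
    rw [Multiset.length_toList, ← hs.natDegree_eq_card_roots, charpoly_natDegree_eq_dim]
  let g : m ≃ Fin A.charpoly.roots.toList.length :=
    (Fintype.equivFin m).trans (finCongr hc.symm)
  refine ⟨fun i => A.charpoly.roots.toList.get (g i), ?_⟩
  rw [g.prod_comp (fun i => Polynomial.X - Polynomial.C (A.charpoly.roots.toList.get i))]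
  conv_lhs => rw [hs.eq_prod_roots_of_monic (charpoly_monic A), ← Multiset.coe_toList A.charpoly.roots]
  rw [Multiset.map_coe, Multiset.prod_coe]
  rw [← List.prod_ofFn]
  conv_lhs => rw [← List.ofFn_get A.charpoly.roots.toList]
  rw [List.map_ofFn]; rfl

lemma aux_count {m : Type*} [Fintype m] [DecidableEq m] (A : Matrix m m ℂ) (v : m → ℂ)
    (h : A.charpoly = ∏ i, (Polynomial.X - Polynomial.C (v i))) (z : ℂ) :
    A.charpoly.roots.count z = (Finset.univ.filter fun i => v i = z).card := by
  rw [h, Polynomial.roots_prod _ _ (Finset.prod_ne_zero_iff.2 fun i _ => Polynomial.X_sub_C_ne_zero _)]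
  simp only [Polynomial.roots_X_sub_C]
  rw [Multiset.count_bind, Finset.card_filter]
  simp only [Multiset.count_singleton, eq_comm]
  rfl

/-- fraction of indices with `v i = z`. -/
noncomputable def aux_frac {m : Type*} [Fintype m] (v : m → ℂ) (z : ℂ) : ℝ :=
  ((Finset.univ.filter fun i => v i = z).card : ℝ) / Fintype.card m

lemma aux_step {m : Type*} [Fintype m] [Nonempty m] (v : m → ℂ) (hv : ∀ i, v i ≠ 0)
    (c : ℝ) (hc : 1/2 < c) (hp : ∀ z, aux_frac v z < c) (z : ℂ) (hz : z ≠ 0) :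
    aux_frac (fun p : m × m => v p.1 * v p.2) z < c ^ 2 + (1 - c) ^ 2 := by
  classical
  have hN : (0 : ℝ) < Fintype.card m := by exact_mod_cast Fintype.card_pos
  set N : ℝ := (Fintype.card m : ℝ) with hNdef
  have hcard : ((Finset.univ.filter fun p : m × m => v p.1 * v p.2 = z).card : ℝ)
      = ∑ i, ((Finset.univ.filter fun j => v j = z / v i).card : ℝ) := by
    rw [Finset.card_filter, Fintype.sum_prod_type]
    push_cast
    refine Finset.sum_congr rfl fun i _ => ?_
    rw [Finset.card_filter]
    push_cast
    refine Finset.sum_congr rfl fun j _ => ?_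
    have : v i * v j = z ↔ v j = z / v i := by rw [eq_div_iff (hv i), mul_comm]
    simp [this]
  have hfr : ∀ y, ((Finset.univ.filter fun j => v j = y).card : ℝ) = aux_frac v y * N := by
    intro y; rw [aux_frac, div_mul_cancel₀ _ hN.ne']
  have key : aux_frac (fun p : m × m => v p.1 * v p.2) z = (∑ i, aux_frac v (z / v i)) / N := by
    unfold aux_frac
    rw [hcard, Fintype.card_prod, Finset.sum_div]
    push_cast
    rw [Finset.sum_div]
    refine Finset.sum_congr rfl fun i _ => ?_
    rw [div_div]
  rw [key, div_lt_iff₀ hN]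
  by_cases hall : ∀ y, aux_frac v y ≤ 1/2
  · calc ∑ i, aux_frac v (z / v i) ≤ ∑ _i : m, (1/2 : ℝ) := Finset.sum_le_sum fun i _ => hall _
      _ = 1/2 * N := by simp [hNdef, mul_comm]
      _ < _ := by
        apply mul_lt_mul_of_pos_right _ hN
        nlinarith [sq_pos_of_pos (sub_pos.2 hc)]
  · push Not at hall
    obtain ⟨y, hy⟩ := hall
    set s := aux_frac v y
    set u := aux_frac v (z / y)
    have hy0 : y ≠ 0 := by
      rintro rfl
      have : s = 0 := by
        simp [s, aux_frac, hv]
      linarith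
    -- for v i ≠ y the two classes are disjoint
    have hdisj : ∀ i, v i ≠ y → aux_frac v (z / v i) ≤ 1 - u := by
      intro i hi
      have hne : z / v i ≠ z / y := by
        intro h
        rw [div_eq_div_iff (hv i) hy0] at h
        exact hi (mul_left_cancel₀ hz h).symm
      have : (Finset.univ.filter fun j => v j = z / v i).card
          + (Finset.univ.filter fun j => v j = z / y).card ≤ Fintype.card m := by
        rw [← Finset.card_union_of_disjoint]
        · exact Finset.card_le_univ _
        · rw [Finset.disjoint_filter]
          intro j _ h1 h2
          exact hne (h1.symm.trans h2)
      have h2 : aux_frac v (z / v i) * N + u * N ≤ N := by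
        rw [← hfr, ← hfr, hNdef]; exact_mod_cast this
      nlinarith
    have hsum : ∑ i, aux_frac v (z / v i) ≤ ∑ i, (if v i = y then u else 1 - u) := by
      refine Finset.sum_le_sum fun i _ => ?_
      split_ifs with h
      · rw [h]
      · exact hdisj i h
    have hsum2 : ∑ i, (if v i = y then u else 1 - u) = N * (s * u + (1 - s) * (1 - u)) := by
      have : ∀ i, (if v i = y then u else 1 - u) = (1 - u) + (2 * u - 1) * (if v i = y then 1 else 0) := by
        intro i; split_ifs <;> ring
      simp only [this]
      rw [Finset.sum_add_distrib, ← Finset.mul_sum, Finset.sum_boole, hfr]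
      simp [← hNdef]
      ring
    rw [hsum2] at hsum
    have hs : s < c := hp y
    have hu : u < c := hp _
    refine hsum.trans_lt ?_
    rw [mul_comm]
    apply mul_lt_mul_of_pos_right _ hN
    nlinarith [mul_pos (sub_pos.2 hs) (sub_pos.2 hc), mul_pos (sub_pos.2 hu) (sub_pos.2 hy)]

theorem aux_reindex_prod {m k : Type} [Fintype m] [Fintype k] (e : m ≃ k) (v : k → ℂ) (z : ℂ) :
    aux_frac (fun i => v (e i)) z = aux_frac v z := by
  unfold aux_frac
  rw [Fintype.card_congr e]
  congr 2
  rw [← Finset.card_map e.toEmbedding]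
  congr 1
  ext j
  simp only [Finset.mem_map_equiv, Finset.mem_filter, Finset.mem_univ, true_and,
    Equiv.apply_symm_apply]

theorem M1_iterated_kronecker_lt {n : ℕ} (A : Matrix (Fin n) (Fin n) ℂ) (hA : IsUnit A)
    (h₁ : 1/2 < M1 A) (h₂ : M1 A < 1) (c : ℝ) (hc₁ : M1 A < c) (hc₂ : c < 1)
    (ι : ℕ → Type) [∀ m, Fintype (ι m)] [∀ m, DecidableEq (ι m)]
    (e₀ : ι 0 ≃ Fin n) (e : ∀ m, ι (m + 1) ≃ ι m × ι m)
    (B : ∀ m, Matrix (ι m) (ι m) ℂ)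
    (hB₀ : B 0 = Matrix.reindex e₀.symm e₀.symm A)
    (hB : ∀ m, B (m + 1) = Matrix.reindex (e m).symm (e m).symm ((B m) ⊗ₖ (B m))) :
    ∀ m, M1 (B m) < (fun x : ℝ => x ^ 2 + (1 - x) ^ 2)^[m] c := by 
  obtain ⟨v, hv⟩ := aux_exists A
  have hM1 : ∀ {k : Type} [Fintype k] [DecidableEq k] (D : Matrix k k ℂ) (w : k → ℂ),
      D.charpoly = ∏ i, (Polynomial.X - Polynomial.C (w i)) → M1 D = aux_frac w 1 := by
    intro k _ _ D w hw
    rw [M1, aux_frac, aux_count D w hw]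
  have hn : 0 < n := by
    rcases Nat.eq_zero_or_pos n with h | h
    · subst h
      simp [M1] at h₁
      norm_num at h₁
    · exact h
  have hn' : (0 : ℝ) < n := by exact_mod_cast hn
  have hv0 : ∀ i, v i ≠ 0 := by
    have hd := aux_det A v hv 0 (-1)
    have hd' : A.det ≠ 0 := ((Matrix.isUnit_iff_isUnit_det A).1 hA).ne_zero
    simp only [zero_smul, neg_smul, one_smul, sub_neg_eq_add, zero_add, neg_mul, one_mul] at hd
    rw [hd] at hd'
    exact fun i => Finset.prod_ne_zero_iff.1 hd' i (Finset.mem_univ i)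
  have hx : M1 A = aux_frac v 1 := hM1 A v hv
  rw [hx] at h₁ h₂ hc₁
  have hbase : ∀ z, aux_frac v z < c := by
    intro z
    by_cases hz : z = 1
    · rw [hz]; exact hc₁
    · have : (Finset.univ.filter fun j => v j = z).card
          + (Finset.univ.filter fun j => v j = 1).card ≤ Fintype.card (Fin n) := by
        rw [← Finset.card_union_of_disjoint]
        · exact Finset.card_le_univ _
        · rw [Finset.disjoint_filter]
          intro j _ h1 h2
          exact hz (h1.symm.trans h2)
      have h2 : aux_frac v z + aux_frac v 1 ≤ 1 := by
        unfold aux_frac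
        rw [← add_div, div_le_one (by simpa using hn')]
        exact_mod_cast this
      linarith
  have main : ∀ m, 1/2 < (fun x : ℝ => x ^ 2 + (1 - x) ^ 2)^[m] c ∧ Nonempty (ι m) ∧
      ∃ w : ι m → ℂ, (B m).charpoly = ∏ i, (Polynomial.X - Polynomial.C (w i)) ∧
        (∀ i, w i ≠ 0) ∧ ∀ z, aux_frac w z < (fun x : ℝ => x ^ 2 + (1 - x) ^ 2)^[m] c := by
    intro m
    induction m with
    | zero =>
      refine ⟨by simpa using h₁.trans hc₁, ⟨e₀.symm ⟨0, hn⟩⟩, fun i => v (e₀ i), ?_,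
        fun i => hv0 _, fun z => ?_⟩
      · rw [hB₀, charpoly_reindex, hv]
        exact (e₀.prod_comp (fun i => Polynomial.X - Polynomial.C (v i))).symm
      · rw [aux_reindex_prod]; exact hbase z
    | succ m ih =>
      obtain ⟨hc, hne, w, hw, hw0, hwz⟩ := ih
      rw [Function.iterate_succ_apply']
      set t := (fun x : ℝ => x ^ 2 + (1 - x) ^ 2)^[m] c
      have ht : 1/2 < t ^ 2 + (1 - t) ^ 2 := by nlinarith [sq_pos_of_pos (sub_pos.2 hc)]
      refine ⟨ht, (e m).nonempty, fun i => w (e m i).1 * w (e m i).2, ?_,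
        fun i => mul_ne_zero (hw0 _) (hw0 _), fun z => ?_⟩
      · rw [hB, charpoly_reindex, aux_kron _ _ w w hw hw]
        exact ((e m).prod_comp
          (fun p => Polynomial.X - Polynomial.C (w p.1 * w p.2))).symm
      · rw [aux_reindex_prod (e m) (fun p => w p.1 * w p.2)]
        by_cases hz : z = 0
        · have : aux_frac (fun p : ι m × ι m => w p.1 * w p.2) z = 0 := by
            simp [aux_frac, hz, hw0]
          rw [this]
          linarith
        · exact aux_step w hw0 t hc hwz z hz
  intro m
  obtain ⟨-, -, w, hw, -, hwz⟩ := main m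
  rw [hM1 _ w hw]
  exact hwz 1
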